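/- Assume M ∉ {0, −2, −4, …}. There is exactly one linear functional T : 𝒫 → ℝ satisfying all of the following: (1) T(x² f) = −T(f) for all f ∈ 𝒫; (2) T(f ∘ g) = T(f) for all f ∈ 𝒫 and all g ∈ SO(m) × Sp(2n); (3) T(H_k H_l) = 0 for all k ≠ l, H_k ∈ ℋ_k, H_l ∈ ℋ_l; (4) T(1) = 2π^{M/2}/Γ(M/2). Namely, T is the Pizzetti integral T(R) = ∑_{k=0}^∞ (−1)^k (2 π^{M/2} / (4^k k! Γ(k + M/2))) (Δ^k R)(0). -/

import Mathlib

set_option synthInstance.maxHeartbeats 1000000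
set_option maxHeartbeats 1000000
open scoped TensorProduct
open MvPolynomial Matrix

noncomputable section

variable (m n : ℕ)

/-- The Grassmann algebra Λ_{2n} on `2n` anticommuting generators. -/
abbrev Grass (n : ℕ) := ExteriorAlgebra ℝ (Fin (2*n) → ℝ)

/-- The algebra of super-polynomials 𝒫 = ℝ[x_1,…,x_m] ⊗ Λ_{2n}. -/
abbrev SuperPoly (m n : ℕ) := MvPolynomial (Fin m) ℝ ⊗[ℝ] Grass n

/-- The fermionic generator x`_i. -/
def fgen (i : Fin (2*n)) : Grass n :=
  ExteriorAlgebra.ι ℝ (Pi.single i (1:ℝ))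

/-- The fermionic partial derivative ∂_{x`_i}, the odd derivation with
∂_{x`_i}(x`_j) = δ_{ij}: contraction with the i-th dual basis vector. -/
def fpderiv (i : Fin (2*n)) : Grass n →ₗ[ℝ] Grass n :=
  CliffordAlgebra.contractLeft (LinearMap.proj i)

/-- The fermionic Laplace operator on Λ_{2n}. -/
def lapF : Grass n →ₗ[ℝ] Grass n :=
  (4:ℝ) • ∑ j : Fin n,
    (fpderiv n ⟨2*j.1, by omega⟩) ∘ₗ (fpderiv n ⟨2*j.1+1, by omega⟩)

/-- The bosonic Laplace operator Δ_b = −∑ ∂_{x_j}² on ℝ[x_1,…,x_m]. -/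
def lapB : MvPolynomial (Fin m) ℝ →ₗ[ℝ] MvPolynomial (Fin m) ℝ :=
  - ∑ j : Fin m, (pderiv j).toLinearMap ∘ₗ (pderiv j).toLinearMap

/-- The super Laplace operator Δ = Δ_b + Δ_f on 𝒫. -/
def lap : SuperPoly m n →ₗ[ℝ] SuperPoly m n :=
  LinearMap.rTensor (Grass n) (lapB m) + LinearMap.lTensor (MvPolynomial (Fin m) ℝ) (lapF n)

/-- x̲² = −∑ x_j². -/
def rb2 : MvPolynomial (Fin m) ℝ := - ∑ j : Fin m, (X j)^2

/-- x`² = ∑_{j=1}^n x`_{2j−1} x`_{2j}. -/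
def rf2 : Grass n := ∑ j : Fin n, fgen n ⟨2*j.1, by omega⟩ * fgen n ⟨2*j.1+1, by omega⟩

/-- The generalized norm squared x² = x̲² + x`² as an element of 𝒫. -/
def r2 : SuperPoly m n := (rb2 m) ⊗ₜ 1 + 1 ⊗ₜ (rf2 n)

/-- The grade-`i` part of the Grassmann algebra. -/
def fgrade (i : ℕ) : Submodule ℝ (Grass n) :=
  (LinearMap.range (ExteriorAlgebra.ι ℝ (M := Fin (2*n) → ℝ)))^i

/-- The space 𝒫_k of super-polynomials homogeneous of total degree k. -/
def P (k : ℕ) : Submodule ℝ (SuperPoly m n) :=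
  ⨆ i : Fin (k+1), Submodule.map₂ (TensorProduct.mk ℝ _ _)
    (homogeneousSubmodule (Fin m) ℝ (k - i.1)) (fgrade n i.1)

/-- The space ℋ_k of spherical harmonics of degree k. -/
def H (k : ℕ) : Submodule ℝ (SuperPoly m n) :=
  P m n k ⊓ LinearMap.ker (lap m n)

/-- The super-dimension M = m − 2n. -/
def sdim : ℤ := (m : ℤ) - 2*n

/-- ℋ^b_p: classical harmonic polynomials of degree p in x_1,…,x_m. -/
def Hb (p : ℕ) : Submodule ℝ (MvPolynomial (Fin m) ℝ) :=
  homogeneousSubmodule (Fin m) ℝ p ⊓ LinearMap.ker (lapB m)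

/-- ℋ^f_q: fermionic (symplectic) harmonics of degree q. -/
def Hf (q : ℕ) : Submodule ℝ (Grass n) :=
  fgrade n q ⊓ LinearMap.ker (lapF n)

/-- ℋ^b_p · ℋ^f_q: the span in 𝒫 of the products H^b H^f. -/
def HbHf (p q : ℕ) : Submodule ℝ (SuperPoly m n) :=
  Submodule.map₂ (TensorProduct.mk ℝ _ _) (Hb m p) (Hf n q)
/-- The polynomial f_{k,p,q} = ∑_{i=0}^k C(k,i)((n−q−i)!/Γ(m/2+p+k−i)) x̲^{2(k−i)} x`^{2i}. -/
def fkpq (m n k p q : ℕ) : SuperPoly m n :=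
  ∑ i ∈ Finset.range (k+1),
    ((Nat.choose k i : ℝ) * ((n - q - i).factorial : ℝ) /
        Real.Gamma ((m:ℝ)/2 + p + k - i)) • (((rb2 m)^(k-i)) ⊗ₜ[ℝ] ((rf2 n)^i))

/-- The 2n × 2n block-diagonal matrix with n diagonal blocks [[0, 1/2], [−1/2, 0]]. -/
def Jmat (n : ℕ) : Matrix (Fin (2*n)) (Fin (2*n)) ℝ := fun i j =>
  if j.1 = i.1 + 1 ∧ i.1 % 2 = 0 then 1/2
  else if i.1 = j.1 + 1 ∧ j.1 % 2 = 0 then -1/2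
  else 0

/-- A ∈ SO(m). -/
def isSO (m : ℕ) (A : Matrix (Fin m) (Fin m) ℝ) : Prop :=
  Aᵀ * A = 1 ∧ A.det = 1

/-- D ∈ Sp(2n). -/
def isSp (n : ℕ) (D : Matrix (Fin (2*n)) (Fin (2*n)) ℝ) : Prop :=
  Dᵀ * Jmat n * D = Jmat n

/-- The action of the pair (A, D) on 𝒫 by algebra automorphisms, via the linear
substitution of variables (x, x`) ↦ (A x, D x`). -/
def act (m n : ℕ) (A : Matrix (Fin m) (Fin m) ℝ) (D : Matrix (Fin (2*n)) (Fin (2*n)) ℝ) :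
    SuperPoly m n →ₐ[ℝ] SuperPoly m n :=
  Algebra.TensorProduct.map
    (aeval (fun j : Fin m => ∑ i : Fin m, A j i • (X i : MvPolynomial (Fin m) ℝ)))
    (ExteriorAlgebra.map (Matrix.toLin' D))

/-- The space of integrations over the supersphere: linear functionals T with
T(x² f) = −T(f) and T(f ∘ g) = T(f) for all g ∈ SO(m) × Sp(2n). -/
def Integrations (m n : ℕ) : Submodule ℝ (SuperPoly m n →ₗ[ℝ] ℝ) where
  carrier := {T | (∀ f, T (r2 m n * f) = - T f) ∧
    (∀ A D, isSO m A → isSp n D → ∀ f, T (act m n A D f) = T f)}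
  add_mem' := by
    rintro T S ⟨hT1, hT2⟩ ⟨hS1, hS2⟩
    refine ⟨fun f => ?_, fun A D hA hD f => ?_⟩
    · simp only [LinearMap.add_apply, hT1 f, hS1 f]; ring
    · simp only [LinearMap.add_apply, hT2 A D hA hD f, hS2 A D hA hD f]
  zero_mem' := by
    refine ⟨fun f => ?_, fun A D hA hD f => ?_⟩ <;> simp
  smul_mem' := by
    rintro c T ⟨hT1, hT2⟩
    refine ⟨fun f => ?_, fun A D hA hD f => ?_⟩
    · simp only [LinearMap.smul_apply, hT1 f, smul_eq_mul]; ring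
    · simp only [LinearMap.smul_apply, hT2 A D hA hD f]

/-- The constant term of a super-polynomial: evaluation at x = x` = 0. -/
def constTerm (m n : ℕ) : SuperPoly m n →ₗ[ℝ] ℝ :=
  (TensorProduct.lid ℝ ℝ).toLinearMap ∘ₗ
    TensorProduct.map (aeval (fun _ : Fin m => (0:ℝ))).toLinearMap
      (ExteriorAlgebra.algebraMapInv).toLinearMap

/-- The Pizzetti integral ∫_SS R = ∑_k (−1)^k (2π^{M/2}/(4^k k! Γ(k+M/2))) (Δ^k R)(0);
the sum has only finitely many nonzero terms for each R. -/
def pizzetti (m n : ℕ) (R : SuperPoly m n) : ℝ :=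
  ∑' k : ℕ, (-1:ℝ)^k *
    (2 * Real.pi ^ ((sdim m n : ℝ)/2) / (4^k * k.factorial * Real.Gamma (k + (sdim m n : ℝ)/2))) *
    constTerm m n (((lap m n)^k) R)

section AdNilpotent

variable {A B : Type*} [Ring A] [Algebra ℝ A] [Ring B] [Algebra ℝ B]

/-- The elements of an algebra annihilated by the `k`-th power of `ad D`. -/
def adNil (D : A) : ℕ → Submodule ℝ A
  | 0 => ⊥
  | k + 1 => (adNil D k).comap (LinearMap.mulLeft ℝ D - LinearMap.mulRight ℝ D)

theorem mem_adNil_zero {D a : A} : a ∈ adNil D 0 ↔ a = 0 := Iff.rfl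

theorem mem_adNil_succ {D a : A} {k : ℕ} :
    a ∈ adNil D (k + 1) ↔ D * a - a * D ∈ adNil D k := Iff.rfl

theorem mem_adNil_one {D a : A} (h : D * a = a * D) : a ∈ adNil D 1 :=
  sub_eq_zero.2 h

theorem mul_mem_adNil {D : A} {s : ℕ} : ∀ {k l : ℕ} {a b : A}, a ∈ adNil D k → b ∈ adNil D l →
    k + l ≤ s + 1 → a * b ∈ adNil D s := by
  induction s with
  | zero =>
    intro k l a b ha hb h
    rcases (by omega : k = 0 ∨ l = 0) with rfl | rfl
    · simp [mem_adNil_zero.1 ha]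
    · simp [mem_adNil_zero.1 hb]
  | succ s ih =>
    intro k l a b ha hb h
    rcases k with _ | k
    · simp [mem_adNil_zero.1 ha]
    rcases l with _ | l
    · simp [mem_adNil_zero.1 hb]
    rw [mem_adNil_succ, show D * (a * b) - a * b * D
      = (D * a - a * D) * b + a * (D * b - b * D) by noncomm_ring]
    exact add_mem (ih (mem_adNil_succ.1 ha) hb (by omega))
      (ih ha (mem_adNil_succ.1 hb) (by omega))

theorem map_mem_adNil (φ : A →ₐ[ℝ] B) {D : A} {E : B} (h : ∀ a, E * φ a - φ a * E
    = φ (D * a - a * D)) {k : ℕ} : ∀ {a : A}, a ∈ adNil D k → φ a ∈ adNil E k := by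
  induction k with
  | zero =>
    intro a ha
    simp [mem_adNil_zero.1 ha]
  | succ k ih =>
    intro a ha
    rw [mem_adNil_succ, h]
    exact ih ha

theorem pow_apply_eq_zero_of_mem_adNil {V : Type*} [AddCommGroup V] [Module ℝ V]
    {D : Module.End ℝ V} {k : ℕ} : ∀ {a : Module.End ℝ V}, a ∈ adNil D k →
    ∀ {v : V}, D v = 0 → (D ^ k) (a v) = 0 := by
  induction k with
  | zero =>
    intro a ha v _
    simp [mem_adNil_zero.1 ha]
  | succ k ih =>
    intro a ha v hv
    have h := ih (mem_adNil_succ.1 ha) hv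
    rw [LinearMap.sub_apply, Module.End.mul_apply, Module.End.mul_apply, hv, map_zero,
      sub_zero] at h
    rwa [pow_succ, Module.End.mul_apply]

end AdNilpotent

section Sl2

variable {V : Type*} [AddCommGroup V] [Module ℝ V] {D X E : Module.End ℝ V} {M : ℝ}

theorem euler_pow_apply (hDE : D * E = E * D + (2 : ℝ) • D) {v : V} {c : ℝ} (hv : E v = c • v)
    (j : ℕ) : E ((D ^ j) v) = (c - 2 * j) • (D ^ j) v := by
  induction j with
  | zero => simpa using hv
  | succ j ih =>
    have h := LinearMap.congr_fun hDE ((D ^ j) v)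
    simp only [Module.End.mul_apply, LinearMap.add_apply, LinearMap.smul_apply, ih, map_smul] at h
    rw [pow_succ', Module.End.mul_apply, ← sub_eq_iff_eq_add.2 h]
    push_cast
    module

theorem euler_pow_mul_apply (hEX : E * X = X * E + (2 : ℝ) • X) {v : V} {c : ℝ}
    (hv : E v = c • v) (j : ℕ) : E ((X ^ j) v) = (c + 2 * j) • (X ^ j) v := by
  induction j with
  | zero => simpa using hv
  | succ j ih =>
    have h := LinearMap.congr_fun hEX ((X ^ j) v)
    simp only [Module.End.mul_apply, LinearMap.add_apply, LinearMap.smul_apply, ih, map_smul] at h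
    rw [pow_succ', Module.End.mul_apply, h]
    push_cast
    module

theorem laplace_pow_norm_apply (hDX : D * X = X * D + (4 : ℝ) • E + (2 * M) • 1)
    (hDE : D * E = E * D + (2 : ℝ) • D) (v : V) (j : ℕ) :
    (D ^ (j + 1)) (X v) = X ((D ^ (j + 1)) v)
      + ((j + 1 : ℝ) * 4) • E ((D ^ j) v) + ((j + 1 : ℝ) * (2 * M + 4 * j)) • (D ^ j) v := by
  induction j with
  | zero => simpa using LinearMap.congr_fun hDX v
  | succ j ih =>
    have h := LinearMap.congr_fun hDX ((D ^ (j + 1)) v)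
    have h' := LinearMap.congr_fun hDE ((D ^ j) v)
    simp only [Module.End.mul_apply, LinearMap.add_apply, LinearMap.smul_apply,
      Module.End.one_apply] at h h'
    have e : ∀ (i : ℕ) w, D ((D ^ i) w) = (D ^ (i + 1)) w := fun i w => by
      rw [pow_succ', Module.End.mul_apply]
    rw [← e (j + 1) (X v), ih, map_add, map_add, h, map_smul, map_smul, h']
    simp only [e]
    push_cast
    module

theorem laplace_norm_pow_apply (hDX : D * X = X * D + (4 : ℝ) • E + (2 * M) • 1)
    (hEX : E * X = X * E + (2 : ℝ) • X) {v : V} {c : ℝ} (hv : E v = c • v) (hD : D v = 0)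
    (j : ℕ) : D ((X ^ (j + 1)) v) = ((j + 1 : ℝ) * (4 * c + 2 * M + 4 * j)) • (X ^ j) v := by
  induction j with
  | zero =>
    have h := LinearMap.congr_fun hDX v
    simp only [Module.End.mul_apply, LinearMap.add_apply, LinearMap.smul_apply,
      Module.End.one_apply, hv, hD, map_zero] at h
    simp only [zero_add, pow_one, pow_zero, Module.End.one_apply, h]
    push_cast
    module
  | succ j ih =>
    have h := LinearMap.congr_fun hDX ((X ^ (j + 1)) v)
    simp only [Module.End.mul_apply, LinearMap.add_apply, LinearMap.smul_apply,
      Module.End.one_apply, euler_pow_mul_apply hEX hv, ih, map_smul] at h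
    rw [pow_succ', Module.End.mul_apply, h, pow_succ' X j, Module.End.mul_apply]
    push_cast
    module

/-- The span of the Fischer components `x²ʲ ℋ_i` with `i + 2 j = k`. -/
def fischerSpan (D X E : Module.End ℝ V) (k : ℕ) : Submodule ℝ V :=
  Submodule.span ℝ {w | ∃ (i j : ℕ) (v : V), i + 2 * j = k ∧ E v = (i : ℝ) • v ∧ D v = 0 ∧
    w = (X ^ j) v}

theorem exists_laplace_norm_eq (hDX : D * X = X * D + (4 : ℝ) • E + (2 * M) • 1)
    (hEX : E * X = X * E + (2 : ℝ) • X) (hM : ∀ j : ℕ, M ≠ -(2 * (j : ℝ))) (k : ℕ) :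
    ∀ w ∈ fischerSpan D X E k, ∃ v ∈ fischerSpan D X E k, D (X v) = w := by
  suffices h : fischerSpan D X E k ≤ (fischerSpan D X E k).map (D * X) from
    fun w hw => h hw
  refine Submodule.span_le.2 ?_
  rintro _ ⟨i, j, v, hk, hE, hD, rfl⟩
  have hc : ((j + 1 : ℝ) * (4 * i + 2 * M + 4 * j)) ≠ 0 := by
    refine mul_ne_zero (by positivity) fun h => hM (i + j) ?_
    push_cast
    linarith
  refine ⟨((j + 1 : ℝ) * (4 * i + 2 * M + 4 * j))⁻¹ • (X ^ j) v,
    Submodule.smul_mem _ _ (Submodule.subset_span ⟨i, j, v, hk, hE, hD, rfl⟩), ?_⟩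
  rw [map_smul, Module.End.mul_apply, ← Module.End.mul_apply X, ← pow_succ',
    laplace_norm_pow_apply hDX hEX hE hD, inv_smul_smul₀ hc]

theorem norm_mem_fischerSpan {k : ℕ} : ∀ w ∈ fischerSpan D X E k,
    X w ∈ fischerSpan D X E (k + 2) := by
  suffices h : fischerSpan D X E k ≤ (fischerSpan D X E (k + 2)).comap X from fun w hw => h hw
  refine Submodule.span_le.2 ?_
  rintro _ ⟨i, j, v, hk, hE, hD, rfl⟩
  refine Submodule.subset_span ⟨i, j + 1, v, by omega, hE, hD, ?_⟩
  rw [pow_succ', Module.End.mul_apply]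

theorem euler_apply_of_mem_fischerSpan (hEX : E * X = X * E + (2 : ℝ) • X) {k : ℕ} {w : V}
    (hw : w ∈ fischerSpan D X E k) : E w = (k : ℝ) • w := by
  induction hw using Submodule.span_induction with
  | mem w hw =>
    obtain ⟨i, j, v, hk, hE, -, rfl⟩ := hw
    rw [euler_pow_mul_apply hEX hE, ← hk]
    push_cast
    rfl
  | zero => simp
  | add x y _ _ hx hy => rw [map_add, hx, hy, smul_add]
  | smul a x _ hx => rw [map_smul, hx, smul_comm]

/-- Fischer decomposition: every eigenvector of the Euler operator is a combination of products of
powers of the squared norm with harmonics. -/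
theorem mem_fischerSpan (hDX : D * X = X * D + (4 : ℝ) • E + (2 * M) • 1)
    (hDE : D * E = E * D + (2 : ℝ) • D) (hEX : E * X = X * E + (2 : ℝ) • X)
    (hM : ∀ j : ℕ, M ≠ -(2 * (j : ℝ))) (hneg : ∀ c < (0 : ℝ), ∀ v, E v = c • v → v = 0) (k : ℕ) :
    ∀ v, E v = (k : ℝ) • v → v ∈ fischerSpan D X E k := by
  have base : ∀ k (v : V), E v = ((k : ℕ) : ℝ) • v → D v = 0 → v ∈ fischerSpan D X E k :=
    fun k v hE hD => Submodule.subset_span ⟨k, 0, v, by simp, hE, hD, by simp⟩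
  induction k using Nat.strong_induction_on with
  | _ k ih =>
    intro v hv
    have hE : E (D v) = ((k : ℝ) - 2) • D v := by
      simpa using euler_pow_apply hDE hv 1
    rcases lt_or_ge k 2 with hk | hk
    · refine base k v hv (hneg _ ?_ _ hE)
      have : (k : ℝ) < 2 := by exact_mod_cast hk
      linarith
    · obtain ⟨l, rfl⟩ := Nat.exists_eq_add_of_le' hk
      obtain ⟨w, hw, hDw⟩ := exists_laplace_norm_eq hDX hEX hM l _
        (ih l (by omega) (D v) (by rw [hE]; push_cast; congr 1; ring))
      have hXw := norm_mem_fischerSpan w hw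
      rw [← sub_add_cancel v (X w)]
      refine add_mem (base _ _ ?_ ?_) hXw
      · rw [map_sub, hv, euler_apply_of_mem_fischerSpan hEX hXw, smul_sub]
      · rw [map_sub, hDw, sub_self]

end Sl2

section Fermionic

variable {n : ℕ}

/-- The index of the fermionic generator `x_{2j-1}`. -/
abbrev fodd (j : Fin n) : Fin (2 * n) := ⟨2 * j.1, by omega⟩

/-- The index of the fermionic generator `x_{2j}`. -/
abbrev feven (j : Fin n) : Fin (2 * n) := ⟨2 * j.1 + 1, by omega⟩

theorem sum_fin_two_mul {V : Type*} [AddCommMonoid V] (f : Fin (2 * n) → V) :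
    ∑ i, f i = ∑ j : Fin n, (f (fodd j) + f (feven j)) := by
  have hp : ∀ (g : ℕ → V) (k : ℕ), ∑ i ∈ Finset.range (2 * k), g i
      = ∑ j ∈ Finset.range k, (g (2 * j) + g (2 * j + 1)) := fun g k => by
    induction k with
    | zero => simp
    | succ k ih =>
      rw [Finset.sum_range_succ, ← ih, show 2 * (k + 1) = 2 * k + 1 + 1 by ring,
        Finset.sum_range_succ, Finset.sum_range_succ, add_assoc]
  have h := hp (fun i => if hi : i < 2 * n then f ⟨i, hi⟩ else 0) n
  rw [Finset.sum_range, Finset.sum_range] at h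
  refine (Finset.sum_congr rfl fun i _ => ?_).trans (h.trans (Finset.sum_congr rfl fun j _ => ?_))
  · rw [dif_pos i.2]
  · rw [dif_pos (by omega), dif_pos (by omega)]

/-- The fermionic Euler operator. -/
def eulerF (n : ℕ) : Module.End ℝ (Grass n) :=
  ∑ i : Fin (2 * n), LinearMap.mulLeft ℝ (fgen n i) * fpderiv n i

theorem fpderiv_ι_mul (i : Fin (2 * n)) (v : Fin (2 * n) → ℝ) (b : Grass n) :
    fpderiv n i (ExteriorAlgebra.ι ℝ v * b) = v i • b - ExteriorAlgebra.ι ℝ v * fpderiv n i b := by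
  unfold fpderiv
  exact CliffordAlgebra.contractLeft_ι_mul _ v b

theorem fpderiv_comm (i j : Fin (2 * n)) (b : Grass n) :
    fpderiv n i (fpderiv n j b) = -fpderiv n j (fpderiv n i b) := by
  unfold fpderiv
  exact CliffordAlgebra.contractLeft_comm _ _ b

theorem fpderiv_algebraMap (i : Fin (2 * n)) (r : ℝ) :
    fpderiv n i (algebraMap ℝ (Grass n) r) = 0 := by
  unfold fpderiv
  exact CliffordAlgebra.contractLeft_algebraMap _ _ r

theorem ι_mul_ι_mul (v w : Fin (2 * n) → ℝ) (b : Grass n) :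
    ExteriorAlgebra.ι ℝ v * (ExteriorAlgebra.ι ℝ w * b)
      = -(ExteriorAlgebra.ι ℝ w * (ExteriorAlgebra.ι ℝ v * b)) := by
  rw [← mul_assoc, ← mul_assoc, ← neg_mul]
  congr 1
  exact eq_neg_of_add_eq_zero_left (ExteriorAlgebra.ι_add_mul_swap v w)

theorem lapF_apply (b : Grass n) :
    lapF n b = (4 : ℝ) • ∑ j : Fin n, fpderiv n (fodd j) (fpderiv n (feven j) b) := by
  simp [lapF]

theorem eulerF_apply (b : Grass n) :
    eulerF n b = ∑ i : Fin (2 * n), fgen n i * fpderiv n i b := by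
  simp [eulerF]

theorem sum_smul_fgen (v : Fin (2 * n) → ℝ) :
    ∑ i, v i • fgen n i = ExteriorAlgebra.ι ℝ v := by
  simp only [fgen, ← map_smul, ← map_sum]
  congr 1
  ext j
  simp [Finset.sum_apply, Pi.single_apply]

theorem lapF_ι_mul (v : Fin (2 * n) → ℝ) (b : Grass n) :
    lapF n (ExteriorAlgebra.ι ℝ v * b) = ExteriorAlgebra.ι ℝ v * lapF n b
      + (4 : ℝ) • ∑ j : Fin n, (v (feven j) • fpderiv n (fodd j) b
        - v (fodd j) • fpderiv n (feven j) b) := by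
  rw [lapF_apply, lapF_apply, mul_smul_comm, ← smul_add, Finset.mul_sum, ← Finset.sum_add_distrib]
  congr 1
  refine Finset.sum_congr rfl fun j _ => ?_
  rw [fpderiv_ι_mul, map_sub, map_smul, fpderiv_ι_mul]
  abel

theorem eulerF_ι_mul (v : Fin (2 * n) → ℝ) (b : Grass n) :
    eulerF n (ExteriorAlgebra.ι ℝ v * b) = ExteriorAlgebra.ι ℝ v * eulerF n b
      + ExteriorAlgebra.ι ℝ v * b := by
  have h : ExteriorAlgebra.ι ℝ v * b = ∑ i, v i • fgen n i * b := by
    rw [← Finset.sum_mul, sum_smul_fgen]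
  rw [eulerF_apply, eulerF_apply, Finset.mul_sum]
  conv_rhs => arg 2; rw [h]
  rw [← Finset.sum_add_distrib]
  refine Finset.sum_congr rfl fun i _ => ?_
  rw [fpderiv_ι_mul, mul_sub, fgen, ι_mul_ι_mul _ v, mul_smul_comm, smul_mul_assoc]
  abel

theorem eulerF_fgen_mul (i : Fin (2 * n)) (b : Grass n) :
    eulerF n (fgen n i * b) = fgen n i * eulerF n b + fgen n i * b :=
  eulerF_ι_mul _ b

theorem fpderiv_eulerF (i : Fin (2 * n)) (b : Grass n) :
    fpderiv n i (eulerF n b) = eulerF n (fpderiv n i b) + fpderiv n i b := by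
  simp only [eulerF_apply, map_sum, fgen, fpderiv_ι_mul, fpderiv_comm i]
  simp [Finset.sum_add_distrib, Pi.single_apply]
  abel

theorem lapF_mul_eulerF : lapF n * eulerF n = eulerF n * lapF n + (2 : ℝ) • lapF n := by
  refine LinearMap.ext fun b => ?_
  simp only [Module.End.mul_apply, LinearMap.add_apply, LinearMap.smul_apply, lapF_apply,
    fpderiv_eulerF, map_add, map_smul, map_sum, Finset.sum_add_distrib]
  module

theorem eulerF_rf2_mul (b : Grass n) :
    eulerF n (rf2 n * b) = rf2 n * eulerF n b + (2 : ℝ) • (rf2 n * b) := by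
  simp only [rf2, Finset.sum_mul, map_sum, mul_assoc, eulerF_fgen_mul, mul_add,
    Finset.sum_add_distrib]
  module

theorem lapF_rf2_mul (b : Grass n) :
    lapF n (rf2 n * b) = rf2 n * lapF n b + (4 : ℝ) • eulerF n b - (4 * n : ℝ) • b := by
  have h : ∀ j : Fin n, lapF n (fgen n (fodd j) * (fgen n (feven j) * b))
      = fgen n (fodd j) * (fgen n (feven j) * lapF n b) + (4 : ℝ) •
        (fgen n (fodd j) * fpderiv n (fodd j) b + fgen n (feven j) * fpderiv n (feven j) b)
        - (4 : ℝ) • b := fun j => by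
    rw [fgen, fgen, lapF_ι_mul, lapF_ι_mul, Finset.sum_eq_single j, Finset.sum_eq_single j]
    · simp [fpderiv_ι_mul, mul_add]
      module
    · intro k _ hk
      simp [Pi.single_apply, Fin.val_inj, hk]
      omega
    · simp
    · intro k _ hk
      simp [Pi.single_apply, Fin.val_inj, hk]
      omega
    · simp
  simp only [rf2, Finset.sum_mul, map_sum, mul_assoc]
  rw [Finset.sum_congr rfl fun j _ => h j, eulerF_apply, sum_fin_two_mul]
  simp only [Finset.sum_sub_distrib, Finset.sum_add_distrib, Finset.smul_sum, smul_add,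
    Finset.sum_const, Finset.card_univ, Fintype.card_fin]
  module

theorem fgrade_induction {C : ℕ → Grass n → Prop} (scalar : ∀ r, C 0 (algebraMap ℝ _ r))
    (add : ∀ i a b, C i a → C i b → C i (a + b))
    (ι_mul : ∀ i v a, C i a → C (i + 1) (ExteriorAlgebra.ι ℝ v * a)) {i : ℕ} {a : Grass n}
    (ha : a ∈ fgrade n i) : C i a := by
  induction ha using Submodule.pow_induction_on_left' with
  | algebraMap r => exact scalar r
  | add x y i _ _ hx hy => exact add i x y hx hy
  | mem_mul v hv i x _ hx =>
    obtain ⟨v, rfl⟩ := hv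
    exact ι_mul i v x hx

theorem eulerF_apply_of_mem {i : ℕ} {a : Grass n} (ha : a ∈ fgrade n i) :
    eulerF n a = (i : ℝ) • a := by
  refine fgrade_induction (C := fun i a => eulerF n a = (i : ℝ) • a) (fun r => ?_)
    (fun i a b ha hb => ?_) (fun i v a ha => ?_) ha
  · simp [eulerF_apply, fpderiv_algebraMap]
  · rw [map_add, ha, hb, smul_add]
  · rw [eulerF_ι_mul, ha, mul_smul_comm]
    push_cast
    module

theorem iSup_fgrade : ⨆ i, fgrade n i = ⊤ :=
  (DirectSum.Decomposition.isInternal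
    (fun i : ℕ => ⋀[ℝ]^i (Fin (2 * n) → ℝ))).submodule_iSup_eq_top

theorem lapF_fpderiv (i : Fin (2 * n)) (b : Grass n) :
    lapF n (fpderiv n i b) = fpderiv n i (lapF n b) := by
  rw [lapF_apply, lapF_apply, map_smul, map_sum]
  congr 1
  refine Finset.sum_congr rfl fun j _ => ?_
  rw [fpderiv_comm _ i, map_neg, fpderiv_comm _ i, neg_neg]

theorem mulLeft_ι_mem_adNil (v : Fin (2 * n) → ℝ) :
    LinearMap.mulLeft ℝ (ExteriorAlgebra.ι ℝ v : Grass n) ∈ adNil (lapF n) 2 := by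
  have h : lapF n * LinearMap.mulLeft ℝ (ExteriorAlgebra.ι ℝ v : Grass n)
      - LinearMap.mulLeft ℝ (ExteriorAlgebra.ι ℝ v : Grass n) * lapF n
      = (4 : ℝ) • ∑ j : Fin n, (v (feven j) • fpderiv n (fodd j)
        - v (fodd j) • fpderiv n (feven j)) := by
    refine LinearMap.ext fun b => ?_
    simp [lapF_ι_mul]
  rw [mem_adNil_succ, h]
  refine mem_adNil_one (LinearMap.ext fun b => ?_)
  simp [lapF_fpderiv]

/-- The grade involution of the Grassmann algebra. -/
def fparity (n : ℕ) : Grass n →ₐ[ℝ] Grass n :=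
  CliffordAlgebra.involute

theorem fparity_ι (v : Fin (2 * n) → ℝ) :
    fparity n (ExteriorAlgebra.ι ℝ v) = -ExteriorAlgebra.ι ℝ v :=
  CliffordAlgebra.involute_ι v

theorem grass_induction {C : Grass n → Prop} (scalar : ∀ r, C (algebraMap ℝ _ r))
    (add : ∀ a b, C a → C b → C (a + b))
    (ι_mul : ∀ a v, C a → C (ExteriorAlgebra.ι ℝ v * a)) (a : Grass n) : C a :=
  CliffordAlgebra.left_induction _ (P := C) scalar add ι_mul a

theorem mul_ι_eq (b : Grass n) (v : Fin (2 * n) → ℝ) :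
    b * ExteriorAlgebra.ι ℝ v = ExteriorAlgebra.ι ℝ v * fparity n b := by
  induction b using grass_induction with
  | scalar r => rw [AlgHom.commutes, Algebra.commutes]
  | add a b ha hb => rw [map_add, mul_add, add_mul, ha, hb]
  | ι_mul a w ha => rw [map_mul, fparity_ι, mul_assoc, ha, neg_mul, mul_neg, ι_mul_ι_mul]

theorem fpderiv_fparity (i : Fin (2 * n)) (b : Grass n) :
    fpderiv n i (fparity n b) = -fparity n (fpderiv n i b) := by
  induction b using grass_induction with
  | scalar r => rw [AlgHom.commutes, fpderiv_algebraMap, map_zero, neg_zero]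
  | add a b ha hb => rw [map_add, map_add, ha, hb, map_add, map_add, neg_add]
  | ι_mul a w ha =>
    rw [map_mul, fparity_ι, neg_mul, map_neg, fpderiv_ι_mul, fpderiv_ι_mul, ha, map_sub, map_mul,
      fparity_ι, map_smul]
    simp

theorem lapF_mul_fparity :
    lapF n * (fparity n).toLinearMap = (fparity n).toLinearMap * lapF n := by
  refine LinearMap.ext fun b => ?_
  simp [lapF_apply, fpderiv_fparity]

theorem mulRight_ι_mem_adNil (v : Fin (2 * n) → ℝ) :
    LinearMap.mulRight ℝ (ExteriorAlgebra.ι ℝ v : Grass n) ∈ adNil (lapF n) 2 := by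
  have h : LinearMap.mulRight ℝ (ExteriorAlgebra.ι ℝ v : Grass n)
      = LinearMap.mulLeft ℝ (ExteriorAlgebra.ι ℝ v) * (fparity n).toLinearMap := by
    refine LinearMap.ext fun b => ?_
    simp [mul_ι_eq]
  rw [h]
  exact mul_mem_adNil (mulLeft_ι_mem_adNil v) (mem_adNil_one lapF_mul_fparity) le_rfl

theorem mul_mem_adNil_of_mem_fgrade {i : ℕ} {a : Grass n} (ha : a ∈ fgrade n i) :
    LinearMap.mulLeft ℝ a ∈ adNil (lapF n) (i + 1) ∧
      LinearMap.mulRight ℝ a ∈ adNil (lapF n) (i + 1) := by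
  refine fgrade_induction (C := fun i a => LinearMap.mulLeft ℝ a ∈ adNil (lapF n) (i + 1) ∧
      LinearMap.mulRight ℝ a ∈ adNil (lapF n) (i + 1)) (fun r => ?_)
    (fun i a b ha hb => ?_) (fun i v a ha => ?_) ha
  · constructor <;> refine mem_adNil_one (LinearMap.ext fun b => ?_) <;>
      simp [← Algebra.commutes, ← Algebra.smul_def]
  · have hl : LinearMap.mulLeft ℝ (a + b) = LinearMap.mulLeft ℝ a + LinearMap.mulLeft ℝ b := by
      refine LinearMap.ext fun c => ?_; simp [add_mul]
    have hr : LinearMap.mulRight ℝ (a + b) = LinearMap.mulRight ℝ a + LinearMap.mulRight ℝ b := by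
      refine LinearMap.ext fun c => ?_; simp [mul_add]
    rw [hl, hr]
    exact ⟨add_mem ha.1 hb.1, add_mem ha.2 hb.2⟩
  · rw [LinearMap.mulLeft_mul, LinearMap.mulRight_mul]
    exact ⟨mul_mem_adNil (mulLeft_ι_mem_adNil v) ha.1 (by omega),
      mul_mem_adNil ha.2 (mulRight_ι_mem_adNil v) (by omega)⟩

theorem fpderiv_map (D : Matrix (Fin (2 * n)) (Fin (2 * n)) ℝ) (i : Fin (2 * n)) (b : Grass n) :
    fpderiv n i (ExteriorAlgebra.map (Matrix.toLin' D) b)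
      = ExteriorAlgebra.map (Matrix.toLin' D) (∑ k, D i k • fpderiv n k b) := by
  induction b using grass_induction with
  | scalar r => simp [fpderiv_algebraMap]
  | add a b ha hb => simp only [map_add, ha, hb, smul_add, Finset.sum_add_distrib]
  | ι_mul a v ha =>
    simp only [map_mul, ExteriorAlgebra.map_apply_ι, fpderiv_ι_mul, ha, smul_sub,
      Finset.sum_sub_distrib, map_sub, map_sum, map_smul, Finset.mul_sum, mul_smul_comm]
    congr 1
    rw [Matrix.toLin'_apply, Matrix.mulVec, dotProduct, Finset.sum_smul]
    simp only [smul_smul]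

theorem lapF_eq_sum_Jmat (b : Grass n) :
    lapF n b = (4 : ℝ) • ∑ i, ∑ j, Jmat n i j • fpderiv n i (fpderiv n j b) := by
  rw [lapF_apply, sum_fin_two_mul]
  congr 1
  refine Finset.sum_congr rfl fun j _ => ?_
  rw [sum_fin_two_mul, sum_fin_two_mul, Finset.sum_eq_single j, Finset.sum_eq_single j]
  · simp [Jmat, fpderiv_comm (feven j) (fodd j)]
    module
  · intro k _ hk
    have h1 : k.1 ≠ j.1 := Fin.val_ne_of_ne hk
    have h4 : 2 * k.1 ≠ 2 * j.1 + 1 := by omega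
    have h5 : 2 * j.1 ≠ 2 * k.1 + 1 := by omega
    simp [Jmat, h1.symm, h4, h5]
  · simp
  · intro k _ hk
    have h1 : k.1 ≠ j.1 := Fin.val_ne_of_ne hk
    have h4 : 2 * k.1 ≠ 2 * j.1 + 1 := by omega
    have h5 : 2 * j.1 ≠ 2 * k.1 + 1 := by omega
    simp [Jmat, h1, h4, h5]
  · simp

theorem sum_comm_four {ι V : Type*} [Fintype ι] [AddCommMonoid V] (G : ι → ι → ι → ι → V) :
    ∑ k, ∑ l, ∑ i, ∑ j, G k l i j = ∑ i, ∑ j, ∑ l, ∑ k, G k l i j := by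
  calc ∑ k, ∑ l, ∑ i, ∑ j, G k l i j
      = ∑ k, ∑ i, ∑ l, ∑ j, G k l i j := Finset.sum_congr rfl fun k _ => Finset.sum_comm
    _ = ∑ i, ∑ k, ∑ l, ∑ j, G k l i j := Finset.sum_comm
    _ = ∑ i, ∑ k, ∑ j, ∑ l, G k l i j :=
      Finset.sum_congr rfl fun i _ => Finset.sum_congr rfl fun k _ => Finset.sum_comm
    _ = ∑ i, ∑ j, ∑ k, ∑ l, G k l i j := Finset.sum_congr rfl fun i _ => Finset.sum_comm
    _ = ∑ i, ∑ j, ∑ l, ∑ k, G k l i j :=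
      Finset.sum_congr rfl fun i _ => Finset.sum_congr rfl fun j _ => Finset.sum_comm

theorem lapF_map {D : Matrix (Fin (2 * n)) (Fin (2 * n)) ℝ} (hD : isSp n D) (b : Grass n) :
    lapF n (ExteriorAlgebra.map (Matrix.toLin' D) b)
      = ExteriorAlgebra.map (Matrix.toLin' D) (lapF n b) := by
  have hJ : ∀ k l, Jmat n k l = ∑ i, ∑ j, D i k * Jmat n i j * D j l := fun k l => by
    conv_lhs => rw [← show Dᵀ * Jmat n * D = Jmat n from hD]
    simp only [Matrix.mul_apply, Matrix.transpose_apply, Finset.sum_mul]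
    exact Finset.sum_comm
  rw [lapF_eq_sum_Jmat, lapF_eq_sum_Jmat, map_smul]
  congr 1
  simp only [fpderiv_map, map_sum, map_smul, Finset.smul_sum, smul_smul]
  have h : ∀ k l, (Jmat n k l) • ExteriorAlgebra.map (Matrix.toLin' D)
        (fpderiv n k (fpderiv n l b)) = ∑ i, ∑ j, (D i k * Jmat n i j * D j l) •
          ExteriorAlgebra.map (Matrix.toLin' D) (fpderiv n k (fpderiv n l b)) := fun k l => by
    conv_lhs => rw [hJ]
    simp only [Finset.sum_smul]
  rw [Finset.sum_congr rfl fun k _ => Finset.sum_congr rfl fun l _ => h k l]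
  refine Eq.trans ?_ (sum_comm_four _).symm
  refine Finset.sum_congr rfl fun i _ => Finset.sum_congr rfl fun j _ =>
    Finset.sum_congr rfl fun l _ => Finset.sum_congr rfl fun k _ => ?_
  congr 1
  ring

end Fermionic

section Bosonic

variable {m : ℕ}

/-- The bosonic Euler operator. -/
def eulerB (m : ℕ) : Module.End ℝ (MvPolynomial (Fin m) ℝ) :=
  ∑ j : Fin m, LinearMap.mulLeft ℝ (X j) * (pderiv j).toLinearMap

theorem eulerB_apply (p : MvPolynomial (Fin m) ℝ) : eulerB m p = ∑ j, X j * pderiv j p := by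
  simp [eulerB]

theorem lapB_apply (p : MvPolynomial (Fin m) ℝ) :
    lapB m p = -∑ j, pderiv j (pderiv j p) := by
  simp [lapB]

theorem pderiv_pderiv_comm (i j : Fin m) (p : MvPolynomial (Fin m) ℝ) :
    pderiv i (pderiv j p) = pderiv j (pderiv i p) := by
  have h : ⁅pderiv (R := ℝ) i, pderiv (R := ℝ) j⁆ = 0 := by
    refine MvPolynomial.derivation_ext fun k => ?_
    simp [Derivation.commutator_apply, pderiv_X, Pi.single_apply, apply_ite]
  have := congrArg (fun d => d p) h
  exact sub_eq_zero.1 (by simpa [Derivation.commutator_apply] using this)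

theorem lapB_X_mul (i : Fin m) (p : MvPolynomial (Fin m) ℝ) :
    lapB m (X i * p) = X i * lapB m p - (2 : ℝ) • pderiv i p := by
  have h : ∀ j : Fin m, pderiv j (pderiv j (X i * p)) = X i * pderiv j (pderiv j p)
      + if j = i then (2 : ℝ) • pderiv i p else 0 := fun j => by
    rcases eq_or_ne j i with rfl | hj
    · simp [two_smul]; ring
    · simp [pderiv_X_of_ne hj.symm, hj]
  simp only [lapB_apply, h, Finset.sum_add_distrib, ← Finset.mul_sum]
  simp
  ring

theorem eulerB_X_mul (i : Fin m) (p : MvPolynomial (Fin m) ℝ) :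
    eulerB m (X i * p) = X i * eulerB m p + X i * p := by
  simp only [eulerB_apply, Derivation.leibniz, smul_eq_mul, pderiv_X, mul_add,
    Finset.sum_add_distrib, Finset.mul_sum]
  congr 1
  · exact Finset.sum_congr rfl fun j _ => by ring
  · simp [Pi.single_apply, mul_comm]

theorem pderiv_eulerB (i : Fin m) (p : MvPolynomial (Fin m) ℝ) :
    pderiv i (eulerB m p) = eulerB m (pderiv i p) + pderiv i p := by
  simp only [eulerB_apply, map_sum, Derivation.leibniz, smul_eq_mul, pderiv_X,
    Finset.sum_add_distrib, pderiv_pderiv_comm i]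
  congr 1
  simp [Pi.single_apply]

theorem lapB_mul_eulerB : lapB m * eulerB m = eulerB m * lapB m + (2 : ℝ) • lapB m := by
  refine LinearMap.ext fun p => ?_
  simp only [Module.End.mul_apply, LinearMap.add_apply, LinearMap.smul_apply, lapB_apply,
    pderiv_eulerB, map_add, map_neg, map_sum, Finset.sum_add_distrib]
  module

theorem eulerB_rb2_mul (p : MvPolynomial (Fin m) ℝ) :
    eulerB m (rb2 m * p) = rb2 m * eulerB m p + (2 : ℝ) • (rb2 m * p) := by
  simp only [rb2, neg_mul, Finset.sum_mul, map_neg, map_sum, sq, mul_assoc, eulerB_X_mul, mul_add,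
    Finset.sum_add_distrib]
  module

theorem lapB_rb2_mul (p : MvPolynomial (Fin m) ℝ) :
    lapB m (rb2 m * p) = rb2 m * lapB m p + (4 : ℝ) • eulerB m p + (2 * m : ℝ) • p := by
  have h : ∀ j : Fin m, lapB m (X j * (X j * p)) = X j * (X j * lapB m p)
      - (4 : ℝ) • (X j * pderiv j p) - (2 : ℝ) • p := fun j => by
    rw [lapB_X_mul, lapB_X_mul, Derivation.leibniz, pderiv_X_self, mul_sub, mul_smul_comm]
    simp only [smul_eq_mul, mul_one]
    module
  simp only [rb2, neg_mul, Finset.sum_mul, map_neg, map_sum, sq, mul_assoc, h,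
    Finset.sum_sub_distrib, ← Finset.smul_sum, ← eulerB_apply]
  simp only [Finset.sum_const, Finset.card_univ, Fintype.card_fin, ← Nat.cast_smul_eq_nsmul ℝ]
  module

theorem eulerB_apply_of_mem {d : ℕ} {p : MvPolynomial (Fin m) ℝ}
    (hp : p ∈ homogeneousSubmodule (Fin m) ℝ d) : eulerB m p = (d : ℝ) • p := by
  rw [eulerB_apply, IsHomogeneous.sum_X_mul_pderiv hp, Nat.cast_smul_eq_nsmul]

theorem iSup_homogeneousSubmodule : ⨆ d, homogeneousSubmodule (Fin m) ℝ d = ⊤ :=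
  letI := MvPolynomial.decomposition (σ := Fin m) (R := ℝ)
  (DirectSum.Decomposition.isInternal (homogeneousSubmodule (Fin m) ℝ)).submodule_iSup_eq_top

theorem mulLeft_X_mem_adNil (i : Fin m) :
    LinearMap.mulLeft ℝ (X i : MvPolynomial (Fin m) ℝ) ∈ adNil (lapB m) 2 := by
  have h : lapB m * LinearMap.mulLeft ℝ (X i) - LinearMap.mulLeft ℝ (X i) * lapB m
      = -(2 : ℝ) • (pderiv i).toLinearMap := by
    refine LinearMap.ext fun p => ?_
    simp [lapB_X_mul]
  rw [mem_adNil_succ, h]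
  refine mem_adNil_one (LinearMap.ext fun p => ?_)
  simp [lapB_apply, fun j => pderiv_pderiv_comm j i]

theorem mulLeft_mem_adNil_of_homogeneous {d : ℕ} {p : MvPolynomial (Fin m) ℝ}
    (hp : p ∈ homogeneousSubmodule (Fin m) ℝ d) :
    LinearMap.mulLeft ℝ p ∈ adNil (lapB m) (d + 1) := by
  have hadd : ∀ p q : MvPolynomial (Fin m) ℝ,
      LinearMap.mulLeft ℝ (p + q) = LinearMap.mulLeft ℝ p + LinearMap.mulLeft ℝ q := fun p q => by
    refine LinearMap.ext fun c => ?_; simp [add_mul]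
  rw [← homogeneousSubmodule_one_pow] at hp
  induction hp using Submodule.pow_induction_on_left' with
  | algebraMap r =>
    refine mem_adNil_one (LinearMap.ext fun b => ?_)
    simp [MvPolynomial.algebraMap_eq, MvPolynomial.C_mul']
  | add x y i _ _ hx hy => rw [hadd]; exact add_mem hx hy
  | mem_mul v hv i x _ hx =>
    rw [LinearMap.mulLeft_mul]
    refine mul_mem_adNil (k := 2) ?_ hx (by omega)
    rw [homogeneousSubmodule_one_eq_span_X] at hv
    induction hv using Submodule.span_induction with
    | mem v hv => obtain ⟨i, rfl⟩ := hv; exact mulLeft_X_mem_adNil i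
    | zero => rw [LinearMap.mulLeft_zero_eq_zero]; exact zero_mem _
    | add p q _ _ hp hq => rw [hadd]; exact add_mem hp hq
    | smul c p _ hp =>
      have : LinearMap.mulLeft ℝ (c • p) = c • LinearMap.mulLeft ℝ p := by
        refine LinearMap.ext fun c => ?_; simp
      rw [this]; exact Submodule.smul_mem _ _ hp

/-- The linear substitution of bosonic variables `x ↦ A x`. -/
abbrev substB (A : Matrix (Fin m) (Fin m) ℝ) :
    MvPolynomial (Fin m) ℝ →ₐ[ℝ] MvPolynomial (Fin m) ℝ :=
  aeval (fun j : Fin m => ∑ i : Fin m, A j i • (X i : MvPolynomial (Fin m) ℝ))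

theorem pderiv_substB (A : Matrix (Fin m) (Fin m) ℝ) (j : Fin m) (p : MvPolynomial (Fin m) ℝ) :
    pderiv j (substB A p) = ∑ i, A i j • substB A (pderiv i p) := by
  induction p using MvPolynomial.induction_on with
  | C r => simp
  | add p q hp hq => simp only [map_add, hp, hq, smul_add, Finset.sum_add_distrib]
  | mul_X p k hp =>
    have hX : pderiv j (substB A (X k)) = algebraMap ℝ _ (A k j) := by
      simp [pderiv_X, Pi.single_apply, Algebra.smul_def]
    rw [map_mul, Derivation.leibniz, hX, hp]
    simp only [Derivation.leibniz, smul_eq_mul, map_add, map_mul, smul_add,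
      Finset.sum_add_distrib, pderiv_X]
    congr 1
    · simp [Pi.single_apply, apply_ite, Algebra.smul_def, mul_comm]
    · simp only [Finset.mul_sum, mul_smul_comm]

theorem lapB_substB {A : Matrix (Fin m) (Fin m) ℝ} (hA : A * Aᵀ = 1) (p : MvPolynomial (Fin m) ℝ) :
    lapB m (substB A p) = substB A (lapB m p) := by
  have h : ∀ i k, ∑ j, A i j * A k j = if i = k then 1 else 0 := fun i k => by
    rw [← Matrix.one_apply, ← hA, Matrix.mul_apply]; rfl
  rw [lapB_apply, lapB_apply, map_neg, map_sum]
  congr 1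
  simp only [pderiv_substB, map_sum, Finset.smul_sum, smul_smul, Derivation.map_smul]
  rw [Finset.sum_comm]
  refine Finset.sum_congr rfl fun i _ => ?_
  rw [Finset.sum_comm]
  simp only [← Finset.sum_smul, h]
  simp

end Bosonic

section SuperPolynomials

variable {m n : ℕ}

/-- The super Euler operator. -/
def euler (m n : ℕ) : Module.End ℝ (SuperPoly m n) :=
  LinearMap.rTensor (Grass n) (eulerB m) + LinearMap.lTensor (MvPolynomial (Fin m) ℝ) (eulerF n)

theorem euler_tmul (p : MvPolynomial (Fin m) ℝ) (q : Grass n) :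
    euler m n (p ⊗ₜ q) = eulerB m p ⊗ₜ q + p ⊗ₜ eulerF n q := by
  simp [euler]

theorem lap_tmul (p : MvPolynomial (Fin m) ℝ) (q : Grass n) :
    lap m n (p ⊗ₜ q) = lapB m p ⊗ₜ q + p ⊗ₜ lapF n q := by
  simp [lap]

theorem r2_mul_tmul (p : MvPolynomial (Fin m) ℝ) (q : Grass n) :
    r2 m n * (p ⊗ₜ q) = (rb2 m * p) ⊗ₜ q + p ⊗ₜ (rf2 n * q) := by
  simp [r2, add_mul]

theorem lapB_eulerB (p : MvPolynomial (Fin m) ℝ) :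
    lapB m (eulerB m p) = eulerB m (lapB m p) + (2 : ℝ) • lapB m p :=
  LinearMap.congr_fun lapB_mul_eulerB p

theorem lapF_eulerF (q : Grass n) :
    lapF n (eulerF n q) = eulerF n (lapF n q) + (2 : ℝ) • lapF n q :=
  LinearMap.congr_fun lapF_mul_eulerF q

theorem lap_mul_mulLeft_r2 : lap m n * LinearMap.mulLeft ℝ (r2 m n)
    = LinearMap.mulLeft ℝ (r2 m n) * lap m n + (4 : ℝ) • euler m n
      + (2 * (sdim m n : ℝ)) • 1 := by
  refine TensorProduct.ext' fun p q => ?_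
  simp only [Module.End.mul_apply, LinearMap.add_apply, LinearMap.smul_apply,
    LinearMap.mulLeft_apply, r2_mul_tmul, map_add, lap_tmul, euler_tmul, lapB_rb2_mul,
    lapF_rf2_mul, TensorProduct.add_tmul, TensorProduct.tmul_add, TensorProduct.tmul_sub,
    ← TensorProduct.smul_tmul', TensorProduct.tmul_smul, Module.End.one_apply, smul_add, sdim]
  push_cast
  module

theorem lap_mul_euler : lap m n * euler m n = euler m n * lap m n + (2 : ℝ) • lap m n := by
  refine TensorProduct.ext' fun p q => ?_
  simp only [Module.End.mul_apply, LinearMap.add_apply, LinearMap.smul_apply, map_add, lap_tmul,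
    euler_tmul, lapB_eulerB, lapF_eulerF, TensorProduct.add_tmul, TensorProduct.tmul_add,
    ← TensorProduct.smul_tmul', TensorProduct.tmul_smul, smul_add]
  module

theorem euler_mul_mulLeft_r2 : euler m n * LinearMap.mulLeft ℝ (r2 m n)
    = LinearMap.mulLeft ℝ (r2 m n) * euler m n + (2 : ℝ) • LinearMap.mulLeft ℝ (r2 m n) := by
  refine TensorProduct.ext' fun p q => ?_
  simp only [Module.End.mul_apply, LinearMap.add_apply, LinearMap.smul_apply,
    LinearMap.mulLeft_apply, r2_mul_tmul, map_add, euler_tmul, eulerB_rb2_mul,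
    eulerF_rf2_mul, TensorProduct.add_tmul, TensorProduct.tmul_add,
    ← TensorProduct.smul_tmul', TensorProduct.tmul_smul, smul_add]
  module

theorem P_le {k : ℕ} {S : Submodule ℝ (SuperPoly m n)}
    (h : ∀ d i, d + i = k → ∀ p ∈ homogeneousSubmodule (Fin m) ℝ d, ∀ q ∈ fgrade n i,
      p ⊗ₜ[ℝ] q ∈ S) : P m n k ≤ S :=
  iSup_le fun i => Submodule.map₂_le.2 fun p hp q hq => h _ _ (by omega) p hp q hq

theorem tmul_mem_P {d i : ℕ} {p : MvPolynomial (Fin m) ℝ} {q : Grass n}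
    (hp : p ∈ homogeneousSubmodule (Fin m) ℝ d) (hq : q ∈ fgrade n i) :
    p ⊗ₜ[ℝ] q ∈ P m n (d + i) := by
  refine Submodule.mem_iSup_of_mem (⟨i, by omega⟩ : Fin (d + i + 1)) ?_
  refine Submodule.apply_mem_map₂ (TensorProduct.mk ℝ _ _) ?_ hq
  rwa [Nat.add_sub_cancel]

theorem iSup_P : ⨆ k, P m n k = ⊤ := by
  rw [eq_top_iff, ← TensorProduct.map₂_mk_top_top_eq_top, ← iSup_homogeneousSubmodule,
    ← iSup_fgrade, Submodule.map₂_iSup_left]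
  refine iSup_le fun d => ?_
  rw [Submodule.map₂_iSup_right]
  refine iSup_le fun i => Submodule.map₂_le.2 fun p hp q hq => ?_
  exact Submodule.mem_iSup_of_mem (d + i) (tmul_mem_P hp hq)

theorem P_le_eigenspace (k : ℕ) : P m n k ≤ (euler m n).eigenspace (k : ℝ) := by
  refine P_le fun d i h p hp q hq => ?_
  rw [Module.End.mem_eigenspace_iff, euler_tmul, eulerB_apply_of_mem hp, eulerF_apply_of_mem hq,
    ← h]
  simp only [← TensorProduct.smul_tmul', TensorProduct.tmul_smul]
  push_cast
  module

theorem euler_apply_of_mem {k : ℕ} {f : SuperPoly m n} (hf : f ∈ P m n k) :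
    euler m n f = (k : ℝ) • f :=
  Module.End.mem_eigenspace_iff.1 (P_le_eigenspace k hf)

theorem P_mul_mem {k l : ℕ} {f g : SuperPoly m n} (hf : f ∈ P m n k) (hg : g ∈ P m n l) :
    f * g ∈ P m n (k + l) := by
  revert f
  suffices h : P m n k ≤ (P m n (k + l)).comap (LinearMap.mulRight ℝ g) from fun f hf => h hf
  refine P_le fun d i hk p hp q hq => ?_
  revert g
  suffices h : P m n l ≤ (P m n (k + l)).comap (LinearMap.mulLeft ℝ (p ⊗ₜ[ℝ] q)) from
    fun g hg => h hg
  refine P_le fun d' i' hl p' hp' q' hq' => ?_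
  rw [Submodule.mem_comap, LinearMap.mulLeft_apply, Algebra.TensorProduct.tmul_mul_tmul, ← hk, ← hl,
    show d + i + (d' + i') = (d + d') + (i + i') by ring]
  refine tmul_mem_P (IsHomogeneous.mul hp hp') ?_
  rw [fgrade, pow_add]
  exact Submodule.mul_mem_mul hq hq'

theorem mem_P_of_euler_apply {k : ℕ} {f : SuperPoly m n} (hf : euler m n f = (k : ℝ) • f) :
    f ∈ P m n k := by
  have htop : f ∈ P m n k ⊔ ⨆ j ≠ k, P m n j := by
    refine (eq_top_iff.2 ?_ : P m n k ⊔ ⨆ j ≠ k, P m n j = ⊤) ▸ Submodule.mem_top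
    rw [← iSup_P]
    refine iSup_le fun j => ?_
    rcases eq_or_ne j k with rfl | hj
    · exact le_sup_left
    · exact (le_iSup₂_of_le (f := fun j (_ : j ≠ k) => P m n j) j hj le_rfl).trans le_sup_right
  obtain ⟨a, ha, b, hb, rfl⟩ := Submodule.mem_sup.1 htop
  have hb0 : b = 0 := by
    refine Submodule.disjoint_def.1 ((euler m n).eigenspaces_iSupIndep (k : ℝ)) b ?_ ?_
    · have h := sub_mem (Module.End.mem_eigenspace_iff.2 hf) (P_le_eigenspace k ha)
      rwa [add_sub_cancel_left] at h
    · refine (iSup₂_le fun j hj => ?_ : (⨆ j ≠ k, P m n j) ≤ _) hb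
      exact le_iSup₂_of_le (j : ℝ) (by exact_mod_cast hj) (P_le_eigenspace j)
  rwa [hb0, add_zero]

theorem eq_zero_of_euler_apply_neg {c : ℝ} (hc : c < 0) (f : SuperPoly m n)
    (hf : euler m n f = c • f) : f = 0 := by
  refine Submodule.disjoint_def.1 ((euler m n).eigenspaces_iSupIndep c) f
    (Module.End.mem_eigenspace_iff.2 hf) ?_
  refine (eq_top_iff.2 ?_ : (⨆ j ≠ c, (euler m n).eigenspace j) = ⊤) ▸ Submodule.mem_top
  rw [← iSup_P]
  refine iSup_le fun j => le_iSup₂_of_le (j : ℝ) ?_ (P_le_eigenspace j)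
  exact (hc.trans_le j.cast_nonneg).ne'

theorem rTensor_mem_adNil {k : ℕ} {a : Module.End ℝ (MvPolynomial (Fin m) ℝ)}
    (ha : a ∈ adNil (lapB m) k) : LinearMap.rTensor (Grass n) a ∈ adNil (lap m n) k := by
  refine map_mem_adNil (B := Module.End ℝ (SuperPoly m n))
    (Module.End.rTensorAlgHom ℝ (MvPolynomial (Fin m) ℝ) (Grass n)) (fun a => ?_) ha
  refine TensorProduct.ext' fun p q => ?_
  change lap m n (LinearMap.rTensor (Grass n) a (p ⊗ₜ q))
      - LinearMap.rTensor (Grass n) a (lap m n (p ⊗ₜ q))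
    = LinearMap.rTensor (Grass n) (lapB m * a - a * lapB m) (p ⊗ₜ q)
  simp [lap_tmul]

theorem lTensor_mem_adNil {k : ℕ} {a : Module.End ℝ (Grass n)} (ha : a ∈ adNil (lapF n) k) :
    LinearMap.lTensor (MvPolynomial (Fin m) ℝ) a ∈ adNil (lap m n) k := by
  refine map_mem_adNil (B := Module.End ℝ (SuperPoly m n))
    (Module.End.lTensorAlgHom ℝ (Grass n) (MvPolynomial (Fin m) ℝ)) (fun a => ?_) ha
  refine TensorProduct.ext' fun p q => ?_
  change lap m n (LinearMap.lTensor (MvPolynomial (Fin m) ℝ) a (p ⊗ₜ q))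
      - LinearMap.lTensor (MvPolynomial (Fin m) ℝ) a (lap m n (p ⊗ₜ q))
    = LinearMap.lTensor (MvPolynomial (Fin m) ℝ) (lapF n * a - a * lapF n) (p ⊗ₜ q)
  simp [lap_tmul]

theorem mulLeft_mem_adNil {k : ℕ} {f : SuperPoly m n} (hf : f ∈ P m n k) :
    LinearMap.mulLeft ℝ f ∈ adNil (lap m n) (k + 1) := by
  revert f
  suffices h : P m n k ≤ (adNil (lap m n) (k + 1)).comap (LinearMap.mul ℝ (SuperPoly m n)) from
    fun f hf => h hf
  refine P_le fun d i hk p hp q hq => ?_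
  have h : LinearMap.mul ℝ (SuperPoly m n) (p ⊗ₜ q) = LinearMap.rTensor (Grass n)
      (LinearMap.mulLeft ℝ p) * LinearMap.lTensor _ (LinearMap.mulLeft ℝ q) :=
    TensorProduct.ext' fun p' q' => by simp
  rw [Submodule.mem_comap, h]
  exact mul_mem_adNil (rTensor_mem_adNil (mulLeft_mem_adNil_of_homogeneous hp))
    (lTensor_mem_adNil (mul_mem_adNil_of_mem_fgrade hq).1) (by omega)

theorem mulRight_mem_adNil {k : ℕ} {f : SuperPoly m n} (hf : f ∈ P m n k) :
    LinearMap.mulRight ℝ f ∈ adNil (lap m n) (k + 1) := by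
  revert f
  suffices h : P m n k ≤ (adNil (lap m n) (k + 1)).comap (LinearMap.mul ℝ (SuperPoly m n)).flip from
    fun f hf => h hf
  refine P_le fun d i hk p hp q hq => ?_
  have h : (LinearMap.mul ℝ (SuperPoly m n)).flip (p ⊗ₜ q) = LinearMap.rTensor (Grass n)
      (LinearMap.mulLeft ℝ p) * LinearMap.lTensor _ (LinearMap.mulRight ℝ q) :=
    TensorProduct.ext' fun p' q' => by simp [mul_comm]
  rw [Submodule.mem_comap, h]
  exact mul_mem_adNil (rTensor_mem_adNil (mulLeft_mem_adNil_of_homogeneous hp))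
    (lTensor_mem_adNil (mul_mem_adNil_of_mem_fgrade hq).2) (by omega)

theorem constTerm_tmul (p : MvPolynomial (Fin m) ℝ) (q : Grass n) :
    constTerm m n (p ⊗ₜ q) = aeval (fun _ => (0 : ℝ)) p * ExteriorAlgebra.algebraMapInv q := by
  simp [constTerm]

theorem constTerm_one : constTerm m n 1 = 1 := by
  rw [Algebra.TensorProduct.one_def, constTerm_tmul, map_one, map_one, one_mul]

theorem algebraMapInv_fgen (i : Fin (2 * n)) : ExteriorAlgebra.algebraMapInv (fgen n i) = 0 := by
  simp [fgen, ExteriorAlgebra.algebraMapInv]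

theorem constTerm_euler (f : SuperPoly m n) : constTerm m n (euler m n f) = 0 := by
  suffices h : constTerm m n ∘ₗ euler m n = 0 from LinearMap.congr_fun h f
  refine TensorProduct.ext' fun p q => ?_
  simp [euler_tmul, constTerm_tmul, eulerB_apply, eulerF_apply, algebraMapInv_fgen]

theorem constTerm_r2_mul (f : SuperPoly m n) : constTerm m n (r2 m n * f) = 0 := by
  suffices h : constTerm m n ∘ₗ LinearMap.mulLeft ℝ (r2 m n) = 0 from LinearMap.congr_fun h f
  refine TensorProduct.ext' fun p q => ?_
  simp [r2_mul_tmul, constTerm_tmul, rb2, rf2, algebraMapInv_fgen]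

theorem act_tmul (A : Matrix (Fin m) (Fin m) ℝ) (D : Matrix (Fin (2 * n)) (Fin (2 * n)) ℝ)
    (p : MvPolynomial (Fin m) ℝ) (q : Grass n) :
    act m n A D (p ⊗ₜ q) = substB A p ⊗ₜ ExteriorAlgebra.map (Matrix.toLin' D) q :=
  rfl

theorem constTerm_act (A : Matrix (Fin m) (Fin m) ℝ) (D : Matrix (Fin (2 * n)) (Fin (2 * n)) ℝ)
    (f : SuperPoly m n) : constTerm m n (act m n A D f) = constTerm m n f := by
  have hB : (aeval (fun _ => (0 : ℝ))).comp (substB A) = aeval (fun _ => (0 : ℝ)) := by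
    refine MvPolynomial.algHom_ext fun i => ?_
    simp
  have hF : ExteriorAlgebra.algebraMapInv.comp (ExteriorAlgebra.map (Matrix.toLin' D))
      = (ExteriorAlgebra.algebraMapInv : Grass n →ₐ[ℝ] ℝ) := by
    refine ExteriorAlgebra.hom_ext (LinearMap.ext fun v => ?_)
    simp [ExteriorAlgebra.algebraMapInv]
  suffices h : constTerm m n ∘ₗ (act m n A D).toLinearMap = constTerm m n from
    LinearMap.congr_fun h f
  refine TensorProduct.ext' fun p q => ?_
  rw [LinearMap.comp_apply, AlgHom.toLinearMap_apply, act_tmul, constTerm_tmul, constTerm_tmul]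
  exact congrArg₂ (· * ·) (DFunLike.congr_fun hB p) (DFunLike.congr_fun hF q)

theorem lap_act {A : Matrix (Fin m) (Fin m) ℝ} (hA : isSO m A)
    {D : Matrix (Fin (2 * n)) (Fin (2 * n)) ℝ} (hD : isSp n D) :
    lap m n ∘ₗ (act m n A D).toLinearMap = (act m n A D).toLinearMap ∘ₗ lap m n := by
  refine TensorProduct.ext' fun p q => ?_
  simp only [LinearMap.comp_apply, AlgHom.toLinearMap_apply, act_tmul, lap_tmul, map_add,
    lapB_substB (mul_eq_one_comm.1 hA.1), lapF_map hD]

theorem lap_pow_act {A : Matrix (Fin m) (Fin m) ℝ} (hA : isSO m A)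
    {D : Matrix (Fin (2 * n)) (Fin (2 * n)) ℝ} (hD : isSp n D) (k : ℕ) (f : SuperPoly m n) :
    (lap m n ^ k) (act m n A D f) = act m n A D ((lap m n ^ k) f) := by
  induction k with
  | zero => rfl
  | succ k ih =>
    rw [pow_succ', Module.End.mul_apply, ih, Module.End.mul_apply]
    exact LinearMap.congr_fun (lap_act hA hD) _

end SuperPolynomials

section Pizzetti

variable {m n : ℕ}

theorem one_mem_H : (1 : SuperPoly m n) ∈ H m n 0 := by
  have h : (1 : SuperPoly m n) ∈ P m n 0 :=
    tmul_mem_P (d := 0) (i := 0) (isHomogeneous_one _ _) (Submodule.one_le.1 le_rfl)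
  refine ⟨h, LinearMap.mem_ker.2 ?_⟩
  have hF : ∀ i, fpderiv n i 1 = 0 := fun i => by
    simpa using fpderiv_algebraMap (n := n) i 1
  rw [Algebra.TensorProduct.one_def, lap_tmul]
  simp [lapB_apply, lapF_apply, hF]

theorem exists_smul_one_of_mem_P_zero {f : SuperPoly m n} (hf : f ∈ P m n 0) :
    ∃ r : ℝ, r • (1 : SuperPoly m n) = f := by
  refine Submodule.mem_span_singleton.1 ((P_le fun d i h p hp q hq => ?_ :
    P m n 0 ≤ Submodule.span ℝ {1}) hf)
  obtain ⟨rfl, rfl⟩ : d = 0 ∧ i = 0 := by omega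
  rw [← homogeneousSubmodule_one_pow, pow_zero] at hp
  rw [fgrade, pow_zero] at hq
  obtain ⟨r, rfl⟩ := Submodule.mem_one.1 hp
  obtain ⟨s, rfl⟩ := Submodule.mem_one.1 hq
  refine Submodule.mem_span_singleton.2 ⟨r * s, ?_⟩
  rw [Algebra.algebraMap_eq_smul_one, Algebra.algebraMap_eq_smul_one,
    TensorProduct.smul_tmul_smul, Algebra.TensorProduct.one_def]

theorem exists_lap_pow_eq_zero (f : SuperPoly m n) : ∃ N, ∀ k ≥ N, (lap m n ^ k) f = 0 := by
  have hf : f ∈ ⨆ k, P m n k := by rw [iSup_P]; exact Submodule.mem_top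
  induction hf using Submodule.iSup_induction' with
  | mem k f hf =>
    refine ⟨k + 1, fun j hj => ?_⟩
    have h := pow_apply_eq_zero_of_mem_adNil (mulLeft_mem_adNil hf) one_mem_H.2
    rw [LinearMap.mulLeft_apply, mul_one] at h
    rw [← Nat.sub_add_cancel hj, pow_add, Module.End.mul_apply, h, map_zero]
  | zero => exact ⟨0, fun k _ => map_zero _⟩
  | add f g _ _ hf hg =>
    obtain ⟨N, hN⟩ := hf
    obtain ⟨N', hN'⟩ := hg
    refine ⟨max N N', fun k hk => ?_⟩
    rw [map_add, hN k (le_of_max_le_left hk), hN' k (le_of_max_le_right hk), add_zero]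

theorem summable_mul_constTerm (c : ℕ → ℝ) (f : SuperPoly m n) :
    Summable fun k => c k * constTerm m n ((lap m n ^ k) f) := by
  obtain ⟨N, hN⟩ := exists_lap_pow_eq_zero f
  refine summable_of_ne_finset_zero (s := Finset.range N) fun k hk => ?_
  rw [hN k (by simpa using hk), map_zero, mul_zero]

/-- The coefficients of the Pizzetti integral in super-dimension `M`. -/
def pizzettiCoeff (M : ℝ) (k : ℕ) : ℝ :=
  (-1) ^ k * (2 * Real.pi ^ (M / 2) / (4 ^ k * k.factorial * Real.Gamma (k + M / 2)))

theorem pizzetti_eq_tsum (f : SuperPoly m n) : pizzetti m n f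
    = ∑' k, pizzettiCoeff (sdim m n) k * constTerm m n ((lap m n ^ k) f) :=
  rfl

theorem pizzettiCoeff_succ {M : ℝ} (hM : ∀ j : ℕ, M ≠ -(2 * (j : ℝ))) (k : ℕ) :
    pizzettiCoeff M (k + 1) * ((k + 1) * (2 * M + 4 * k)) = -pizzettiCoeff M k := by
  have hne : (k : ℝ) + M / 2 ≠ 0 := fun h => hM k (by linarith)
  have hG : Real.Gamma (k + M / 2) ≠ 0 :=
    Real.Gamma_ne_zero fun j h => hM (k + j) (by push_cast; linarith)
  have hk : (k : ℝ) + 1 ≠ 0 := by positivity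
  have hfac : (k.factorial : ℝ) ≠ 0 := by exact_mod_cast k.factorial_ne_zero
  have hΓ : Real.Gamma ((k + 1 : ℕ) + M / 2) = (k + M / 2) * Real.Gamma (k + M / 2) := by
    rw [← Real.Gamma_add_one hne]
    push_cast
    ring_nf
  rw [pizzettiCoeff, pizzettiCoeff, hΓ, Nat.factorial_succ, pow_succ, pow_succ,
    show 2 * M + 4 * (k : ℝ) = 4 * (k + M / 2) by ring]
  push_cast
  generalize (k : ℝ) + M / 2 = a at *
  field_simp

/-- The Pizzetti integral as a linear functional. -/
def pizzettiLinear (m n : ℕ) : SuperPoly m n →ₗ[ℝ] ℝ where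
  toFun := pizzetti m n
  map_add' f g := by
    simp only [pizzetti_eq_tsum, map_add, mul_add]
    exact (summable_mul_constTerm _ f).tsum_add (summable_mul_constTerm _ g)
  map_smul' c f := by
    simp only [pizzetti_eq_tsum, map_smul, smul_eq_mul, RingHom.id_apply, ← tsum_mul_left]
    exact tsum_congr fun k => by ring

theorem constTerm_lap_pow_r2_mul (f : SuperPoly m n) (k : ℕ) :
    constTerm m n ((lap m n ^ (k + 1)) (r2 m n * f))
      = ((k + 1) * (2 * sdim m n + 4 * k)) * constTerm m n ((lap m n ^ k) f) := by
  have h := laplace_pow_norm_apply lap_mul_mulLeft_r2 lap_mul_euler f k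
  rw [LinearMap.mulLeft_apply, LinearMap.mulLeft_apply] at h
  rw [h, map_add, map_add, map_smul, map_smul, constTerm_r2_mul, constTerm_euler]
  simp

theorem pizzetti_r2_mul (hM : ∀ j : ℕ, (sdim m n : ℝ) ≠ -(2 * (j : ℝ))) (f : SuperPoly m n) :
    pizzetti m n (r2 m n * f) = -pizzetti m n f := by
  rw [pizzetti_eq_tsum, pizzetti_eq_tsum, (summable_mul_constTerm _ _).tsum_eq_zero_add, pow_zero,
    Module.End.one_apply, constTerm_r2_mul, mul_zero, zero_add, ← tsum_neg]
  refine tsum_congr fun k => ?_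
  rw [constTerm_lap_pow_r2_mul, ← mul_assoc, pizzettiCoeff_succ hM, neg_mul]

theorem pizzetti_act {A : Matrix (Fin m) (Fin m) ℝ} (hA : isSO m A)
    {D : Matrix (Fin (2 * n)) (Fin (2 * n)) ℝ} (hD : isSp n D) (f : SuperPoly m n) :
    pizzetti m n (act m n A D f) = pizzetti m n f := by
  simp only [pizzetti_eq_tsum, lap_pow_act hA hD, constTerm_act]

theorem pizzetti_mul_eq_zero {k l : ℕ} (hkl : k ≠ l) {f g : SuperPoly m n} (hf : f ∈ H m n k)
    (hg : g ∈ H m n l) : pizzetti m n (f * g) = 0 := by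
  rw [pizzetti_eq_tsum]
  refine (tsum_congr fun j => ?_).trans tsum_zero
  rw [mul_eq_zero]
  right
  by_cases hj : k + l = 2 * j
  · rcases lt_or_gt_of_ne hkl with h | h
    · have h0 := pow_apply_eq_zero_of_mem_adNil (mulLeft_mem_adNil hf.1) hg.2
      rw [LinearMap.mulLeft_apply] at h0
      rw [← Nat.sub_add_cancel (show k + 1 ≤ j by omega), pow_add, Module.End.mul_apply, h0,
        map_zero, map_zero]
    · have h0 := pow_apply_eq_zero_of_mem_adNil (mulRight_mem_adNil hg.1) hf.2
      rw [LinearMap.mulRight_apply] at h0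
      rw [← Nat.sub_add_cancel (show l + 1 ≤ j by omega), pow_add, Module.End.mul_apply, h0,
        map_zero, map_zero]
  · have h := congrArg (constTerm m n)
      (euler_pow_apply lap_mul_euler (euler_apply_of_mem (P_mul_mem hf.1 hg.1)) j)
    rw [constTerm_euler, map_smul, smul_eq_mul] at h
    refine (mul_eq_zero.1 h.symm).resolve_left (sub_ne_zero.2 ?_)
    exact_mod_cast hj

theorem pizzetti_one : pizzetti m n 1
    = 2 * Real.pi ^ ((sdim m n : ℝ) / 2) / Real.Gamma ((sdim m n : ℝ) / 2) := by
  rw [pizzetti_eq_tsum, tsum_eq_single 0 fun k hk => ?_]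
  · simp [pizzettiCoeff, constTerm_one]
  · obtain ⟨k, rfl⟩ := Nat.exists_eq_succ_of_ne_zero hk
    rw [pow_succ, Module.End.mul_apply, LinearMap.mem_ker.1 one_mem_H.2, map_zero, map_zero,
      mul_zero]

/-- A functional that changes sign under multiplication by `x²` is determined by its values on the
spherical harmonics. -/
theorem eq_zero_of_vanish_on_H (hM : ∀ j : ℕ, (sdim m n : ℝ) ≠ -(2 * (j : ℝ)))
    {S : SuperPoly m n →ₗ[ℝ] ℝ} (hr : ∀ f, S (r2 m n * f) = -S f)
    (hH : ∀ k, ∀ f ∈ H m n k, S f = 0) : S = 0 := by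
  rw [← LinearMap.ker_eq_top, eq_top_iff, ← iSup_P]
  refine iSup_le fun k f hf => ?_
  refine (Submodule.span_le.2 ?_ :
    fischerSpan (lap m n) (LinearMap.mulLeft ℝ (r2 m n)) (euler m n) k ≤ LinearMap.ker S)
    (mem_fischerSpan lap_mul_mulLeft_r2 lap_mul_euler euler_mul_mulLeft_r2 hM
      (fun c hc => eq_zero_of_euler_apply_neg hc) k f (euler_apply_of_mem hf))
  rintro _ ⟨i, j, v, -, hv, hD, rfl⟩
  have h0 : S v = 0 := hH i v ⟨mem_P_of_euler_apply hv, hD⟩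
  change S _ = 0
  induction j with
  | zero => exact h0
  | succ j ih => rw [pow_succ', Module.End.mul_apply, LinearMap.mulLeft_apply, hr, ih, neg_zero]

end Pizzetti

/-- assume M ∉ {0, −2, −4, …}.  A linear functional T : 𝒫 → ℝ satisfies
(1) T(x²f) = −T(f), (2) invariance under SO(m)×Sp(2n), (3) orthogonality of spherical
harmonics of different degrees, and (4) T(1) = 2π^{M/2}/Γ(M/2), if and only if T is the
Pizzetti integral; in particular there is exactly one such functional. -/
theorem pizzetti_unique (m n : ℕ) (hm : 1 ≤ m) (hn : 1 ≤ n)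
    (hM : ∀ j : ℕ, sdim m n ≠ -(2*(j:ℤ))) (T : SuperPoly m n →ₗ[ℝ] ℝ) :
    ((∀ f, T (r2 m n * f) = - T f) ∧
     (∀ A D, isSO m A → isSp n D → ∀ f, T (act m n A D f) = T f) ∧
     (∀ k l : ℕ, k ≠ l → ∀ Hk ∈ H m n k, ∀ Hl ∈ H m n l, T (Hk * Hl) = 0) ∧
     T 1 = 2 * Real.pi ^ ((sdim m n : ℝ)/2) / Real.Gamma ((sdim m n : ℝ)/2))
    ↔ (∀ f, T f = pizzetti m n f) := by
  have hM' : ∀ j : ℕ, (sdim m n : ℝ) ≠ -(2 * (j : ℝ)) := fun j => by exact_mod_cast hM j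
  constructor
  · rintro ⟨hr, -, hH, h1⟩
    refine LinearMap.congr_fun (sub_eq_zero.1 ?_ : T = pizzettiLinear m n)
    have hone : (T - pizzettiLinear m n) 1 = 0 :=
      sub_eq_zero.2 (h1.trans pizzetti_one.symm)
    refine eq_zero_of_vanish_on_H hM' (fun f => ?_) (fun k f hf => ?_)
    · rw [LinearMap.sub_apply, LinearMap.sub_apply, hr]
      change _ - pizzetti m n _ = -(_ - pizzetti m n _)
      rw [pizzetti_r2_mul hM']
      ring
    · rcases eq_or_ne k 0 with rfl | hk
      · obtain ⟨r, rfl⟩ := exists_smul_one_of_mem_P_zero hf.1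
        rw [map_smul, hone, smul_zero]
      · have hT := hH k 0 hk f hf 1 one_mem_H
        have hP := pizzetti_mul_eq_zero hk hf one_mem_H
        rw [mul_one] at hT hP
        exact sub_eq_zero.2 (hT.trans hP.symm)
  · intro hT
    refine ⟨fun f => ?_, fun A D hA hD f => ?_, fun k l hkl f hf g hg => ?_, ?_⟩
    · rw [hT, hT, pizzetti_r2_mul hM']
    · rw [hT, hT, pizzetti_act hA hD]
    · rw [hT, pizzetti_mul_eq_zero hkl hf hg]
    · rw [hT, pizzetti_one]

end
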